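/- For every integer n ≥ 1 there exists a finite simple graph G with maximum degree Δ(G) = 2n and acyclic b-chromatic number A_b(G) = 2n² + 1 = (1/2)·Δ(G)² + 1; hence the upper bound A_b(G) ≤ (1/2)·Δ(G)² + 1 is attained by an infinite family of graphs. -/

import Mathlib

open SimpleGraph

namespace AcyclicB

variable {V : Type*}

/-- `c` is a proper vertex coloring of `G`. -/
def Proper (G : SimpleGraph V) (c : V → ℕ) : Prop :=
  ∀ ⦃u v : V⦄, G.Adj u v → c u ≠ c v

/-- `c` is an acyclic (proper) coloring of `G`: the subgraph induced by the union of
any two color classes is a forest. -/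
def IsAcyclicColoring (G : SimpleGraph V) (c : V → ℕ) : Prop :=
  Proper G c ∧ ∀ i j : ℕ, (G.induce {v | c v = i ∨ c v = j}).IsAcyclic

/-- The closed neighborhood of `v` in `G`. -/
def closedNbhd (G : SimpleGraph V) (v : V) : Set V :=
  insert v (G.neighborSet v)

/-- `c'` is obtained from the acyclic coloring `c` by an acyclic recoloring step removing
one color `i`: every vertex of a color different from `i` keeps its color, and every vertex
of color `i` receives a color (among the colors of `c`, different from `i`) that is absent
from its closed neighborhood; the resulting coloring is again acyclic. -/
def RecolorStep (G : SimpleGraph V) (c' c : V → ℕ) : Prop :=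
  IsAcyclicColoring G c ∧ IsAcyclicColoring G c' ∧
  ∃ i ∈ Set.range c,
    (∀ v, c v ≠ i → c' v = c v) ∧
    (∀ v, c v = i → c' v ∈ Set.range c ∧ c' v ≠ i ∧
      ∀ u ∈ closedNbhd G v, c u ≠ c' v)

/-- The strict partial order `≺ₐ` on acyclic colorings: the transitive closure of the
acyclic recoloring step relation. -/
def StrictOrder (G : SimpleGraph V) : (V → ℕ) → (V → ℕ) → Prop :=
  Relation.TransGen (RecolorStep G)

/-- `c` is a minimal element of `≺ₐ`: an acyclic coloring admitting no acyclic recoloring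
step. -/
def IsMinimal (G : SimpleGraph V) (c : V → ℕ) : Prop :=
  IsAcyclicColoring G c ∧ ∀ c', ¬ RecolorStep G c' c

/-- The number of colors used by `c`. -/
def ncolors [Fintype V] (c : V → ℕ) : ℕ :=
  (Finset.univ.image c).card

/-- The acyclic b-chromatic number of `G`: the maximum number of colors used by a minimal
element of `≺ₐ`. -/
noncomputable def Ab [Fintype V] (G : SimpleGraph V) : ℕ :=
  sSup { k | ∃ c : V → ℕ, IsMinimal G c ∧ ncolors c = k }

/-- The acyclic chromatic number of `G`: the minimum number of colors in an acyclic
proper coloring. -/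
noncomputable def Achrom [Fintype V] (G : SimpleGraph V) : ℕ :=
  sInf { k | ∃ c : V → ℕ, IsAcyclicColoring G c ∧ ncolors c = k }

/-- The join of two graphs: disjoint copies of `G` and `H` together with all edges
between them. -/
def join {α β : Type*} (G : SimpleGraph α) (H : SimpleGraph β) : SimpleGraph (α ⊕ β) where
  Adj x y :=
    match x, y with
    | Sum.inl a, Sum.inl a' => G.Adj a a'
    | Sum.inr b, Sum.inr b' => H.Adj b b'
    | Sum.inl _, Sum.inr _ => True
    | Sum.inr _, Sum.inl _ => True
  symm := by
    refine ⟨?_⟩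
    rintro (a | b) (a' | b') h
    · exact G.adj_symm h
    · trivial
    · trivial
    · exact H.adj_symm h
  loopless := by
    refine ⟨?_⟩
    rintro (a | b) h
    · exact G.loopless.irrefl a h
    · exact H.loopless.irrefl b h

end AcyclicB

namespace AcyclicB

section Coloring

variable {V : Type*} {G : SimpleGraph V} {c : V → ℕ}

theorem exists_two_neighbors_of_isCycle {u x : V} {w : G.Walk u u} (hw : w.IsCycle)
    (hx : x ∈ w.support) :
    ∃ y ∈ w.support, ∃ z ∈ w.support, y ≠ z ∧ G.Adj x y ∧ G.Adj x z := by
  classical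
  have hc : (w.rotate x hx).IsCycle := hw.rotate hx
  exact ⟨_, (w.mem_support_rotate_iff x hx).1 (Walk.getVert_mem_support _ _), _,
    (w.mem_support_rotate_iff x hx).1 (Walk.getVert_mem_support _ _), hc.snd_ne_penultimate,
    Walk.adj_snd hc.not_nil, (Walk.adj_penultimate hc.not_nil).symm⟩

theorem isAcyclic_induce_iff {s : Set V} :
    (G.induce s).IsAcyclic ↔
      ∀ (u : V) (w : G.Walk u u), w.IsCycle → ¬ ∀ x ∈ w.support, x ∈ s := by
  constructor
  · intro h u w hw hs
    refine h (w.induce s hs) (Walk.IsCycle.of_map (f := (Embedding.induce s).toHom) ?_)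
    rw [Walk.map_induce]
    exact hw
  · intro h u w hw
    refine h _ (w.map (Embedding.induce s).toHom) (hw.map Subtype.val_injective) ?_
    intro x hx
    rw [Walk.support_map, List.mem_map] at hx
    obtain ⟨y, -, rfl⟩ := hx
    exact y.2

/-- A coloring is acyclic as soon as every edge has an endpoint whose neighbors have pairwise
distinct colors. -/
theorem isAcyclicColoring_of_injOn_neighborSet (hp : Proper G c)
    (h : ∀ u v, G.Adj u v → Set.InjOn c (G.neighborSet u) ∨ Set.InjOn c (G.neighborSet v)) :
    IsAcyclicColoring G c := by
  refine ⟨hp, fun i j => isAcyclic_induce_iff.2 fun u w hw hs => ?_⟩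
  have key : ∀ x ∈ w.support, ¬ Set.InjOn c (G.neighborSet x) := by
    intro x hx hinj
    obtain ⟨y, hy, z, hz, hne, hxy, hxz⟩ := exists_two_neighbors_of_isCycle hw hx
    refine hne (hinj hxy hxz ?_)
    have h1 := hs x hx
    have h2 := hs y hy
    have h3 := hs z hz
    have h4 := hp hxy
    have h5 := hp hxz
    simp only [Set.mem_ofPred_eq] at h1 h2 h3
    omega
  obtain ⟨y, hy, -, -, -, huy, -⟩ := exists_two_neighbors_of_isCycle hw w.start_mem_support
  exact (h u y huy).elim (key u w.start_mem_support) (key y hy)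

theorem IsAcyclicColoring.update [DecidableEq V] (hc : IsAcyclicColoring G c) {v : V} {k : ℕ}
    (hk : ∀ u, G.Adj v u → c u ≠ k)
    (hk' : ∀ y z, G.Adj v y → G.Adj v z → y ≠ z → c y = c z →
      ∀ y' z', G.Adj y y' → G.Adj z z' → y' ≠ v → z' ≠ v → c y' = k → c z' ≠ k) :
    IsAcyclicColoring G (Function.update c v k) := by
  have hp : Proper G (Function.update c v k) := by
    intro a b hab
    have hne := hab.ne
    by_cases ha : a = v
    · subst ha
      rw [Function.update_self, Function.update_of_ne hne.symm]
      exact (hk b hab).symm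
    · by_cases hb : b = v
      · subst hb
        rw [Function.update_self, Function.update_of_ne ha]
        exact hk a hab.symm
      · rw [Function.update_of_ne ha, Function.update_of_ne hb]
        exact hc.1 hab
  refine ⟨hp, fun i j => isAcyclic_induce_iff.2 fun u w hw hs => ?_⟩
  simp only [Set.mem_ofPred_eq] at hs
  by_cases hv : v ∈ w.support
  · obtain ⟨y, hy, z, hz, hne, hvy, hvz⟩ := exists_two_neighbors_of_isCycle hw hv
    have far : ∀ x ∈ w.support, G.Adj v x → ∃ x', G.Adj x x' ∧ x' ≠ v ∧ c x' = k := by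
      intro x hx hvx
      obtain ⟨a, ha, b, hb, hab, hxa, hxb⟩ := exists_two_neighbors_of_isCycle hw hx
      have color : ∀ d ∈ w.support, G.Adj x d → d ≠ v → c d = k := by
        intro d hd hxd hdv
        have h1 := hs v hv
        have h2 := hs x hx
        have h3 := hs d hd
        have h4 := hp hvx
        have h5 := hp hxd
        rw [Function.update_self] at h1 h4
        rw [Function.update_of_ne hdv] at h3 h5
        omega
      by_cases hav : a = v
      · exact ⟨b, hxb, fun h => hab (hav.trans h.symm), color b hb hxb fun h =>
          hab (hav.trans h.symm)⟩
      · exact ⟨a, hxa, hav, color a ha hxa hav⟩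
    obtain ⟨y', hyy', hy'v, hy'⟩ := far y hy hvy
    obtain ⟨z', hzz', hz'v, hz'⟩ := far z hz hvz
    refine hk' y z hvy hvz hne ?_ y' z' hyy' hzz' hy'v hz'v hy' hz'
    have h1 := hs v hv
    have h2 := hs y hy
    have h3 := hs z hz
    have h4 := hp hvy
    have h5 := hp hvz
    rw [Function.update_self] at h1 h4 h5
    rw [Function.update_of_ne hvy.ne'] at h2 h4
    rw [Function.update_of_ne hvz.ne'] at h3 h5
    omega
  · refine isAcyclic_induce_iff.1 (hc.2 i j) u w hw fun x hx => ?_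
    have := hs x hx
    rwa [Function.update_of_ne (ne_of_mem_of_not_mem hx hv)] at this

end Coloring

section UpperBound

variable {V : Type*} [Fintype V] {G : SimpleGraph V} [DecidableRel G.Adj] {c : V → ℕ}

/-- A set of at most `Δ² / 2` colors contains every color that cannot be given to `v`. -/
theorem exists_forbidden (c : V → ℕ) (hΔ : 2 ≤ G.maxDegree) (v : V) :
    ∃ F : Finset ℕ, 2 * F.card ≤ G.maxDegree ^ 2 ∧ ∀ k ∉ F,
      (∀ u, G.Adj v u → c u ≠ k) ∧
      (∀ y z, G.Adj v y → G.Adj v z → y ≠ z → c y = c z →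
        ∀ y' z', G.Adj y y' → G.Adj z z' → y' ≠ v → z' ≠ v → c y' = k → c z' ≠ k) := by
  classical
  let N := G.neighborFinset v
  let far : V → Finset ℕ := fun y => ((G.neighborFinset y).erase v).image c
  let R := N.filter fun y => ∃ z ∈ N, z ≠ y ∧ c z = c y
  let U := N.filter fun y => ¬ ∃ z ∈ N, z ≠ y ∧ c z = c y
  let B := (R.biUnion far).filter fun k =>
    ∃ y ∈ R, ∃ z ∈ R, y ≠ z ∧ k ∈ far y ∧ k ∈ far z
  have hRU : R.card + U.card = N.card := Finset.card_filter_add_card_filter_not _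
  have hN : N.card ≤ G.maxDegree := by
    rw [G.card_neighborFinset_eq_degree]
    exact G.degree_le_maxDegree v
  have hR : 2 * (R.image c).card ≤ R.card := by
    refine Finset.mul_card_image_le_card R 2 fun b hb => ?_
    obtain ⟨y, hy, rfl⟩ := Finset.mem_image.1 hb
    obtain ⟨hyN, z, hzN, hzy, hcz⟩ := Finset.mem_filter.1 hy
    refine Finset.one_lt_card.2 ⟨y, ?_, z, ?_, hzy.symm⟩
    · exact Finset.mem_filter.2 ⟨hy, rfl⟩
    · exact Finset.mem_filter.2 ⟨Finset.mem_filter.2 ⟨hzN, y, hyN, hzy.symm, hcz.symm⟩, hcz⟩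
  have hU : (U.image c).card ≤ U.card := Finset.card_image_le
  have hfar : ∀ y ∈ R, (far y).card ≤ G.maxDegree - 1 := by
    intro y hy
    have hvy : G.Adj v y := (G.mem_neighborFinset v y).1 (Finset.mem_filter.1 hy).1
    refine Finset.card_image_le.trans ?_
    rw [Finset.card_erase_of_mem ((G.mem_neighborFinset y v).2 hvy.symm),
      G.card_neighborFinset_eq_degree]
    exact Nat.sub_le_sub_right (G.degree_le_maxDegree y) 1
  have hB : 2 * B.card ≤ R.card * (G.maxDegree - 1) := by
    calc 2 * B.card = ∑ _k ∈ B, 2 := by rw [Finset.sum_const, smul_eq_mul, mul_comm]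
      _ ≤ ∑ k ∈ B, (R.bipartiteAbove (fun k y => k ∈ far y) k).card := by
        refine Finset.sum_le_sum fun k hk => ?_
        obtain ⟨-, y, hy, z, hz, hyz, hky, hkz⟩ := Finset.mem_filter.1 hk
        exact Finset.one_lt_card.2 ⟨y, Finset.mem_filter.2 ⟨hy, hky⟩, z,
          Finset.mem_filter.2 ⟨hz, hkz⟩, hyz⟩
      _ = ∑ y ∈ R, (B.bipartiteBelow (fun k y => k ∈ far y) y).card :=
        Finset.sum_card_bipartiteAbove_eq_sum_card_bipartiteBelow _
      _ ≤ ∑ _y ∈ R, (G.maxDegree - 1) := by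
        refine Finset.sum_le_sum fun y hy => (Finset.card_le_card ?_).trans (hfar y hy)
        intro k hk
        exact (Finset.mem_filter.1 hk).2
      _ = R.card * (G.maxDegree - 1) := by rw [Finset.sum_const, smul_eq_mul]
  refine ⟨R.image c ∪ U.image c ∪ B, ?_, fun k hk => ?_⟩
  · have h1 : (R.image c ∪ U.image c ∪ B).card ≤
        (R.image c).card + (U.image c).card + B.card :=
      (Finset.card_union_le _ _).trans (Nat.add_le_add_right (Finset.card_union_le _ _) _)
    obtain ⟨d, hd⟩ : ∃ d, G.maxDegree = d + 2 := ⟨_, (Nat.sub_add_cancel hΔ).symm⟩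
    rw [hd] at hB hN ⊢
    have h2 : d + 2 - 1 = d + 1 := rfl
    rw [h2] at hB
    nlinarith
  · rw [Finset.mem_union, Finset.mem_union, not_or, not_or] at hk
    obtain ⟨⟨hkR, hkU⟩, hkB⟩ := hk
    refine ⟨fun u hu huk => ?_, fun y z hy hz hne hyz y' z' hyy' hzz' hy'v hz'v hy' hz' => hkB ?_⟩
    · have huN : u ∈ N := (G.mem_neighborFinset v u).2 hu
      by_cases h : ∃ z ∈ N, z ≠ u ∧ c z = c u
      · exact hkR (Finset.mem_image.2 ⟨u, Finset.mem_filter.2 ⟨huN, h⟩, huk⟩)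
      · exact hkU (Finset.mem_image.2 ⟨u, Finset.mem_filter.2 ⟨huN, h⟩, huk⟩)
    · have hyN : y ∈ N := (G.mem_neighborFinset v y).2 hy
      have hzN : z ∈ N := (G.mem_neighborFinset v z).2 hz
      have hyR : y ∈ R := Finset.mem_filter.2 ⟨hyN, z, hzN, hne.symm, hyz.symm⟩
      have hzR : z ∈ R := Finset.mem_filter.2 ⟨hzN, y, hyN, hne, hyz⟩
      have hky : k ∈ far y := Finset.mem_image.2
        ⟨y', Finset.mem_erase.2 ⟨hy'v, (G.mem_neighborFinset y y').2 hyy'⟩, hy'⟩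
      have hkz : k ∈ far z := Finset.mem_image.2
        ⟨z', Finset.mem_erase.2 ⟨hz'v, (G.mem_neighborFinset z z').2 hzz'⟩, hz'⟩
      exact Finset.mem_filter.2
        ⟨Finset.mem_biUnion.2 ⟨y, hyR, hky⟩, y, hyR, z, hzR, hne, hky, hkz⟩

/-- With more than `Δ² / 2 + 1` colors, the vertices of a color class can be recolored greedily. -/
theorem IsAcyclicColoring.exists_recoloring (hc : IsAcyclicColoring G c) (hΔ : 2 ≤ G.maxDegree)
    (hcard : G.maxDegree ^ 2 + 2 < 2 * ncolors c) (i : ℕ) (S : Finset V)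
    (hS : ∀ v ∈ S, c v = i) :
    ∃ c', IsAcyclicColoring G c' ∧ (∀ v ∉ S, c' v = c v) ∧
      ∀ v ∈ S, c' v ∈ Set.range c ∧ c' v ≠ i ∧ ∀ u ∈ closedNbhd G v, c u ≠ c' v := by
  classical
  induction S using Finset.induction_on with
  | empty => exact ⟨c, hc, fun _ _ => rfl, by simp⟩
  | insert v S hv ih =>
    obtain ⟨d, hd, hdS, hdS'⟩ := ih fun u hu => hS u (Finset.mem_insert_of_mem hu)
    obtain ⟨F, hF, hFk⟩ := exists_forbidden d hΔ v
    have hvi : c v = i := hS v (Finset.mem_insert_self v S)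
    obtain ⟨k, hk, hkF⟩ : ∃ k ∈ Finset.univ.image c, k ∉ insert i F := by
      by_contra! h
      have h1 := Finset.card_le_card h
      have h2 := Finset.card_insert_le i F
      unfold ncolors at hcard
      omega
    rw [Finset.mem_insert, not_or] at hkF
    obtain ⟨hki, hkF⟩ := hkF
    refine ⟨Function.update d v k, hd.update (hFk k hkF).1 (hFk k hkF).2, fun u hu => ?_,
      fun u hu => ?_⟩
    · rw [Finset.mem_insert, not_or] at hu
      rw [Function.update_of_ne hu.1, hdS u hu.2]
    · by_cases huv : u = v
      · subst huv
        rw [Function.update_self]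
        refine ⟨by simpa using hk, hki, fun x hx => ?_⟩
        rcases hx with rfl | hx
        · exact fun h => hki (h.symm.trans hvi)
        · have hxS : x ∉ S := fun h => hc.1 hx
            (hvi.trans (hS x (Finset.mem_insert_of_mem h)).symm)
          rw [← hdS x hxS]
          exact (hFk k hkF).1 x hx
      · rw [Function.update_of_ne huv]
        exact hdS' u ((Finset.mem_insert.1 hu).resolve_left huv)

theorem IsMinimal.two_mul_ncolors_le (hc : IsMinimal G c) (hΔ : 2 ≤ G.maxDegree) :
    2 * ncolors c ≤ G.maxDegree ^ 2 + 2 := by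
  classical
  by_contra! h
  obtain ⟨i, hi⟩ : (Finset.univ.image c).Nonempty := by
    rw [← Finset.card_pos]
    unfold ncolors at h
    omega
  obtain ⟨c', hc', h1, h2⟩ := hc.1.exists_recoloring hΔ h i (Finset.univ.filter (c · = i))
    (by simp)
  exact hc.2 c' ⟨hc.1, hc', i, by simpa using hi, fun v hv => h1 v (by simpa using hv),
    fun v hv => h2 v (by simpa using hv)⟩

end UpperBound

section Construction

/-- The colors: one for the root, and for each of the `n` blocks a hub color and `m` leaf
colors. -/
abbrev Color (n m : ℕ) : Type := Option (Fin n × Option (Fin m))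

/-- The vertices of a gadget: a root (`none`), and for each of the `n` blocks two hubs and `m`
leaves. -/
abbrev Gadget (n m : ℕ) : Type := Option (Fin n × (Bool ⊕ Fin m))

variable {n m : ℕ}

/-- Each hub is joined to the root and to all leaves of its block. -/
def Spoke : Gadget n m → Gadget n m → Prop
  | some (_, Sum.inl _), none => True
  | some (p, Sum.inl _), some (q, Sum.inr _) => p = q
  | _, _ => False

/-- The coloring of a gadget, in which the two hubs of a block share their color. -/
def gadgetColor : Gadget n m → Color n m
  | none => none
  | some (p, Sum.inl _) => some (p, none)
  | some (p, Sum.inr k) => some (p, some k)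

/-- Disjoint copies of the gadget (`n` copies of `K_{2,m+1}` sharing a root), one for each
color. -/
def gadgetGraph (n m : ℕ) : SimpleGraph (Color n m × Gadget n m) where
  Adj x y := x.1 = y.1 ∧ (Spoke x.2 y.2 ∨ Spoke y.2 x.2)
  symm := ⟨fun _ _ h => ⟨h.1.symm, h.2.symm⟩⟩
  loopless := ⟨by rintro ⟨t, _ | ⟨p, _ | k⟩⟩ ⟨-, h | h⟩ <;> exact h⟩

/-- The coloring of `gadgetGraph n m` in which the copy indexed by `t` has a root of color `t`. -/
noncomputable def gadgetColoring (n m : ℕ) (x : Color n m × Gadget n m) : ℕ :=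
  Fintype.equivFin (Color n m) (Equiv.swap none x.1 (gadgetColor x.2))

theorem gadgetColoring_eq_iff (t : Color n m) (x y : Gadget n m) :
    gadgetColoring n m (t, x) = gadgetColoring n m (t, y) ↔ gadgetColor x = gadgetColor y := by
  simp [gadgetColoring, Fin.val_inj]

theorem gadgetColoring_root (t : Color n m) :
    gadgetColoring n m (t, none) = Fintype.equivFin (Color n m) t := by
  simp [gadgetColoring, gadgetColor]

theorem ncolors_gadgetColoring : ncolors (gadgetColoring n m) = n * (m + 1) + 1 := by
  have h : Finset.univ.image (gadgetColoring n m) =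
      Finset.univ.image fun t : Color n m => (Fintype.equivFin (Color n m) t : ℕ) := by
    ext k
    simp only [Finset.mem_image, Finset.mem_univ, true_and]
    constructor
    · rintro ⟨x, rfl⟩
      exact ⟨_, rfl⟩
    · rintro ⟨t, rfl⟩
      exact ⟨(t, none), gadgetColoring_root t⟩
  have hinj : Function.Injective fun t : Color n m => (Fintype.equivFin (Color n m) t : ℕ) :=
    Fin.val_injective.comp (Equiv.injective _)
  rw [ncolors, h, Finset.card_image_of_injective _ hinj]
  simp

theorem Spoke.gadgetColor_ne {x y : Gadget n m} (h : Spoke x y) :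
    gadgetColor x ≠ gadgetColor y := by
  rcases x with _ | ⟨p, _ | k⟩ <;> rcases y with _ | ⟨q, _ | l⟩ <;>
    simp_all [Spoke, gadgetColor]

theorem Spoke.injOn {x y : Gadget n m} (h : Spoke x y) (t : Color n m) :
    Set.InjOn (gadgetColoring n m) ((gadgetGraph n m).neighborSet (t, x)) := by
  rintro ⟨s, a⟩ ⟨rfl, ha⟩ ⟨s, b⟩ ⟨rfl, hb⟩ hab
  rw [gadgetColoring_eq_iff] at hab
  rcases x with _ | ⟨p, _ | k⟩ <;> rcases y with _ | ⟨q, _ | l⟩ <;>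
    rcases a with _ | ⟨p', _ | k'⟩ <;> rcases b with _ | ⟨q', _ | l'⟩ <;>
    simp_all [Spoke, gadgetColor]

theorem isAcyclicColoring_gadgetColoring :
    IsAcyclicColoring (gadgetGraph n m) (gadgetColoring n m) := by
  refine isAcyclicColoring_of_injOn_neighborSet ?_ ?_
  · rintro ⟨t, x⟩ ⟨s, y⟩ ⟨rfl, h | h⟩ <;> rw [Ne, gadgetColoring_eq_iff]
    · exact h.gadgetColor_ne
    · exact h.gadgetColor_ne.symm
  · rintro ⟨t, x⟩ ⟨s, y⟩ ⟨rfl, h | h⟩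
    · exact Or.inl (h.injOn t)
    · exact Or.inr (h.injOn t)

theorem isMinimal_gadgetColoring : IsMinimal (gadgetGraph n m) (gadgetColoring n m) := by
  refine ⟨isAcyclicColoring_gadgetColoring, ?_⟩
  rintro c' ⟨-, hc', i, ⟨⟨t₀, x₀⟩, hi⟩, hkeep, hnew⟩
  obtain ⟨t, ht⟩ : ∃ t, gadgetColoring n m (t, none) = i :=
    ⟨_, (gadgetColoring_root _).trans hi⟩
  obtain ⟨⟨⟨s, y⟩, hy⟩, hne, hnbr⟩ := hnew (t, none) ht
  have keep : ∀ p a, c' (t, some (p, a)) = gadgetColoring n m (t, some (p, a)) := by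
    intro p a
    refine hkeep _ ?_
    rw [← ht, Ne, gadgetColoring_eq_iff]
    rcases a with a | a <;> simp [gadgetColor]
  have hub : ∀ p b, (gadgetGraph n m).Adj (t, none) (t, some (p, Sum.inl b)) :=
    fun p b => ⟨rfl, Or.inr trivial⟩
  have leaf : ∀ p b k, (gadgetGraph n m).Adj (t, some (p, Sum.inl b)) (t, some (p, Sum.inr k)) :=
    fun p b k => ⟨rfl, Or.inl rfl⟩
  have hcolor : ∃ z : Color n m, c' (t, none) =
      Fintype.equivFin (Color n m) (Equiv.swap none t z) :=
    ⟨Equiv.swap none t (Equiv.swap none s (gadgetColor y)), by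
      rw [Equiv.swap_apply_self]; exact hy.symm⟩
  obtain ⟨_ | ⟨p, _ | k⟩, hz⟩ := hcolor
  · exact hne (hz.trans ht)
  · exact hnbr (t, some (p, Sum.inl true)) (Or.inr (hub p true)) hz.symm
  · have hroot : c' (t, none) = c' (t, some (p, Sum.inr k)) := by
      rw [keep, hz]
      rfl
    have hhub : c' (t, some (p, Sum.inl false)) = c' (t, some (p, Sum.inl true)) := by
      rw [keep, keep]
      rfl
    let w : (gadgetGraph n m).Walk (t, none) (t, none) :=
      Walk.cons (hub p true) (Walk.cons (leaf p true k)
        (Walk.cons (leaf p false k).symm (Walk.cons (hub p false).symm Walk.nil)))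
    have hw : w.IsCycle := by simp [w, Walk.cons_isCycle_iff]
    refine isAcyclic_induce_iff.1 (hc'.2 (c' (t, none)) (c' (t, some (p, Sum.inl true)))) _ w hw ?_
    simp [w, ← hroot, hhub]

theorem maxDegree_gadgetGraph [DecidableRel (gadgetGraph n m).Adj] (hn : 1 ≤ n)
    (hm : m + 1 = 2 * n) : (gadgetGraph n m).maxDegree = 2 * n := by
  classical
  apply le_antisymm
  · refine maxDegree_le_of_forall_degree_le _ _ ?_
    rintro ⟨t, x⟩
    rw [← card_neighborFinset_eq_degree]
    rcases x with _ | ⟨p, b | k⟩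
    · have h : (gadgetGraph n m).neighborFinset (t, none) ⊆
          Finset.univ.image fun a : Fin n × Bool => (t, some (a.1, Sum.inl a.2)) := by
        rintro ⟨s, _ | ⟨q, _ | l⟩⟩ hs <;> rw [mem_neighborFinset] at hs <;>
          obtain ⟨rfl, h⟩ := hs <;> simp_all [Spoke]
      refine (Finset.card_le_card h).trans (Finset.card_image_le.trans ?_)
      simp [mul_comm]
    · have h : (gadgetGraph n m).neighborFinset (t, some (p, Sum.inl b)) ⊆
          Finset.univ.image fun a : Option (Fin m) =>
            (t, a.map fun l => (p, Sum.inr l)) := by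
        rintro ⟨s, _ | ⟨q, _ | l⟩⟩ hs <;> rw [mem_neighborFinset] at hs <;>
          obtain ⟨rfl, h⟩ := hs <;> simp_all [Spoke]
      refine (Finset.card_le_card h).trans (Finset.card_image_le.trans ?_)
      simp [hm]
    · have h : (gadgetGraph n m).neighborFinset (t, some (p, Sum.inr k)) ⊆
          Finset.univ.image fun a : Bool => (t, some (p, Sum.inl a)) := by
        rintro ⟨s, _ | ⟨q, _ | l⟩⟩ hs <;> rw [mem_neighborFinset] at hs <;>
          obtain ⟨rfl, h⟩ := hs <;> simp_all [Spoke]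
      refine (Finset.card_le_card h).trans (Finset.card_image_le.trans ?_)
      rw [Finset.card_univ, Fintype.card_bool]
      omega
  · refine le_trans ?_ ((gadgetGraph n m).degree_le_maxDegree (none, none))
    rw [← card_neighborFinset_eq_degree]
    have h : (Finset.univ.image fun a : Fin n × Bool => ((none : Color n m),
        (some (a.1, Sum.inl a.2) : Gadget n m))) ⊆
          (gadgetGraph n m).neighborFinset (none, none) := by
      intro x hx
      obtain ⟨a, -, rfl⟩ := Finset.mem_image.1 hx
      rw [mem_neighborFinset]
      exact ⟨rfl, Or.inr trivial⟩
    refine le_trans ?_ (Finset.card_le_card h)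
    rw [Finset.card_image_of_injective]
    · simp [mul_comm]
    · rintro ⟨p, a⟩ ⟨q, b⟩ hab
      simpa using hab

end Construction

/-- For every `n ≥ 1` there is a finite simple graph `G` with `Δ(G) = 2n` and
`A_b(G) = 2n² + 1 = (1/2)·Δ(G)² + 1`: the bound `A_b(G) ≤ (1/2)·Δ(G)² + 1` is attained
by an infinite family of graphs. -/
theorem exists_ab_eq_half_maxDegree_sq (n : ℕ) (hn : 1 ≤ n) :
    ∃ (V : Type) (_ : Fintype V) (G : SimpleGraph V) (_ : DecidableRel G.Adj),
      G.maxDegree = 2 * n ∧ Ab G = 2 * n ^ 2 + 1 ∧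
      (Ab G : ℝ) = (G.maxDegree : ℝ) ^ 2 / 2 + 1 := by
  classical
  obtain ⟨m, hm⟩ : ∃ m, m + 1 = 2 * n := ⟨2 * n - 1, by omega⟩
  have hΔ := maxDegree_gadgetGraph hn hm
  have hAb : Ab (gadgetGraph n m) = 2 * n ^ 2 + 1 := by
    refine IsGreatest.csSup_eq ⟨⟨gadgetColoring n m, isMinimal_gadgetColoring, ?_⟩, ?_⟩
    · rw [ncolors_gadgetColoring, hm]
      ring
    · rintro k ⟨c, hc, rfl⟩
      have h := hc.two_mul_ncolors_le (by omega)
      rw [hΔ] at h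
      linarith
  refine ⟨_, inferInstance, gadgetGraph n m, inferInstance, hΔ, hAb, ?_⟩
  rw [hAb, hΔ]
  push_cast
  ring

end AcyclicB
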